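/- Let J ⊆ S = 𝕜[x_{1,1},…,x_{1,n_1},…,x_{k,1},…,x_{k,n_k}] be a monomial ideal, and let I ⊆ R be the ideal generated by the lifts m̄ = ∏_{i=1}^{k} ∏_{j=1}^{n_i} ∏_{l=1}^{a_{i,j}} (x_{i,j} − (l−1)x_{i,0}) of the monomial generators m = ∏_{i,j} x_{i,j}^{a_{i,j}} of J. Let M be the set of monomials of S not lying in J, and let M̄ = { [1:b_{1,1}:⋯:b_{1,n_1}] × ⋯ × [1:b_{k,1}:⋯:b_{k,n_k}] ∈ ℙ^{n_1} × ⋯ × ℙ^{n_k} : ∏_{i,j} x_{i,j}^{b_{i,j}} ∈ M }. Then I = 𝐈(M̄), the ideal of all polynomials of R vanishing on M̄. -/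

import Mathlib

open MvPolynomial

noncomputable section

namespace PaperMP

variable (K : Type) [Field K] [IsAlgClosed K] [CharZero K]
variable (k : ℕ) (n : Fin k → ℕ)

/-- Index type of the variables `x_{i,j}`, `1 ≤ i ≤ k`, `0 ≤ j ≤ n i`. -/
abbrev Sig := Σ i : Fin k, Fin (n i + 1)

/-- The `ℕ^k`-graded polynomial ring `R`. -/
abbrev MPRing := MvPolynomial (Sig k n) K

/-- The grading of `R`: `deg x_{i,j} = e_i`. -/
def wt : Sig k n → (Fin k → ℕ) := fun p => Pi.single p.1 1

/-- A point of `ℙ^{n_1} × ⋯ × ℙ^{n_k}`. -/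
abbrev MPPoint := ∀ i : Fin k, Projectivization K (Fin (n i + 1) → K)

/-- The affine cone over a point of multiprojective space. -/
def cone (P : MPPoint K k n) : Set (Sig k n → K) :=
  {x | ∀ i : Fin k, ∃ c : K, (fun j => x ⟨i, j⟩) = c • (P i).rep}

/-- Vanishing ideal of a set of points of affine space. -/
def vanishingIdeal (T : Set (Sig k n → K)) : Ideal (MPRing K k n) :=
  ⨅ x ∈ T, RingHom.ker (MvPolynomial.eval x)

/-- The (prime) ideal `I_P` of a point of multiprojective space. -/
def idealOfPoint (P : MPPoint K k n) : Ideal (MPRing K k n) :=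
  vanishingIdeal K k n (cone K k n P)

/-- The ideal `I_X` of a set of points of multiprojective space. -/
def idealOfSet (X : Set (MPPoint K k n)) : Ideal (MPRing K k n) :=
  ⨅ P ∈ X, idealOfPoint K k n P

/-- The Hilbert function of `R/I` in multidegree `d`. -/
def hilb (I : Ideal (MPRing K k n)) (d : Fin k → ℕ) : ℕ :=
  Module.finrank K ((weightedHomogeneousSubmodule K (wt k n) d).map
    (Ideal.Quotient.mkₐ K I).toLinearMap)

/-- The irrelevant maximal ideal `m = (x_{1,0},…,x_{k,n_k})`. -/
def maxIdeal : Ideal (MPRing K k n) :=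
  Ideal.span (Set.range (MvPolynomial.X : Sig k n → MPRing K k n))

/-- `L` is a regular sequence modulo `I`:  `(I,L) ⊆ m`, and each entry is a
non-zero divisor modulo `I` together with the previous entries. -/
def IsRegSeqMod (I : Ideal (MPRing K k n)) (L : List (MPRing K k n)) : Prop :=
  I ⊔ Ideal.span {f | f ∈ L} ≤ maxIdeal K k n ∧
  ∀ i : Fin L.length, ∀ G : MPRing K k n,
    L.get i * G ∈ I ⊔ Ideal.span {f | f ∈ L.take i} →
      G ∈ I ⊔ Ideal.span {f | f ∈ L.take i}

/-- `depth R/I = l`: `l` is the length of a maximal regular sequence modulo `I`. -/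
def hasDepth (I : Ideal (MPRing K k n)) (l : ℕ) : Prop :=
  IsGreatest {r : ℕ | ∃ L : List (MPRing K k n), L.length = r ∧ IsRegSeqMod K k n I L} l

/-- `X` is arithmetically Cohen–Macaulay: `depth R/I_X = K-dim R/I_X = k`. -/
def IsACM (X : Set (MPPoint K k n)) : Prop :=
  hasDepth K k n (idealOfSet K k n X) k

/-! ### The first difference function -/

/-- Extend `H : ℕ^k → ℕ` by zero outside ℕ^k. -/
def extNeg (H : (Fin k → ℕ) → ℕ) (j : Fin k → ℤ) : ℤ :=
  if ∀ i, 0 ≤ j i then H (fun i => (j i).toNat) else 0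

/-- The first difference function `ΔH` of a numerical function `H : ℕ^k → ℕ`. -/
def delta (H : (Fin k → ℕ) → ℕ) (d : Fin k → ℕ) : ℤ :=
  ∑ l : Fin k → Fin 2, (-1 : ℤ) ^ (∑ i, (l i : ℕ)) *
    extNeg k H (fun i => (d i : ℤ) - (l i : ℕ))

/-! ### The ring `S = k[x_{1,1},…,x_{k,n_k}]` -/

/-- Index type of the variables `x_{i,j}`, `1 ≤ i ≤ k`, `1 ≤ j ≤ n i`. -/
abbrev SigS := Σ i : Fin k, Fin (n i)

/-- The `ℕ^k`-graded polynomial ring `S`. -/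
abbrev SRing := MvPolynomial (SigS k n) K

/-- The grading of `S`: `deg x_{i,j} = e_i`. -/
def wtS : SigS k n → (Fin k → ℕ) := fun p => Pi.single p.1 1

/-- The Hilbert function of `S/J` in multidegree `d`. -/
def hilbS (J : Ideal (SRing K k n)) (d : Fin k → ℕ) : ℕ :=
  Module.finrank K ((weightedHomogeneousSubmodule K (wtS k n) d).map
    (Ideal.Quotient.mkₐ K J).toLinearMap)

/-- `J` is an `ℕ^k`-homogeneous ideal of `S`. -/
def IsHomogIdealS (J : Ideal (SRing K k n)) : Prop :=
  ∀ f ∈ J, ∀ d : Fin k → ℕ, weightedHomogeneousComponent (wtS k n) d f ∈ J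

/-- `J` is an artinian ideal of `S`: `√J = (x_{1,1},…,x_{k,n_k})`. -/
def IsArtinianIdealS (J : Ideal (SRing K k n)) : Prop :=
  J.radical = Ideal.span (Set.range (MvPolynomial.X : SigS k n → SRing K k n))

/-! ### The ring `k[x_1,…,x_k]`, with `deg x_i = e_i` -/

abbrev TRing := MvPolynomial (Fin k) K

/-- The grading: `deg x_i = e_i`. -/
def wtT : Fin k → (Fin k → ℕ) := fun i => Pi.single i 1

/-- The Hilbert function of `k[x_1,…,x_k]/I` in multidegree `d`. -/
def hilbT (I : Ideal (TRing K k)) (d : Fin k → ℕ) : ℕ :=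
  Module.finrank K ((weightedHomogeneousSubmodule K (wtT k) d).map
    (Ideal.Quotient.mkₐ K I).toLinearMap)

/-- `I` is an `ℕ^k`-homogeneous ideal of `k[x_1,…,x_k]`. -/
def IsHomogIdealT (I : Ideal (TRing K k)) : Prop :=
  ∀ f ∈ I, ∀ d : Fin k → ℕ, weightedHomogeneousComponent (wtT k) d f ∈ I

/-- `I` is an artinian ideal of `k[x_1,…,x_k]`: `√I = (x_1,…,x_k)`. -/
def IsArtinianIdealT (I : Ideal (TRing K k)) : Prop :=
  I.radical = Ideal.span (Set.range (MvPolynomial.X : Fin k → TRing K k))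

/-! ### Lifting monomial ideals -/

/-- The lift `m̄ = ∏_{i,j} ∏_{l=1}^{a_{i,j}} (x_{i,j} - (l-1) x_{i,0})` of the monomial
of `S` with exponent vector `b`, via the lifting matrix `𝒜`. -/
def liftMonomial (b : SigS k n →₀ ℕ) : MPRing K k n :=
  ∏ p ∈ b.support, ∏ l ∈ Finset.range (b p),
    (MvPolynomial.X (⟨p.1, p.2.succ⟩ : Sig k n) - (l : MPRing K k n) * MvPolynomial.X ⟨p.1, 0⟩)

/-- `J` is a monomial ideal of `S`. -/
def IsMonomialIdeal (J : Ideal (SRing K k n)) : Prop :=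
  ∃ A : Set (SigS k n →₀ ℕ), J = Ideal.span ((fun b => (monomial b (1 : K) : SRing K k n)) '' A)

/-- The exponent vectors of the minimal monomial generators of a monomial ideal `J ⊆ S`. -/
def minGens (J : Ideal (SRing K k n)) : Set (SigS k n →₀ ℕ) :=
  {b | (monomial b (1 : K) : SRing K k n) ∈ J ∧
    ∀ b' : SigS k n →₀ ℕ, b' ≤ b → b' ≠ b → (monomial b' (1 : K) : SRing K k n) ∉ J}

/-- The lift to `R` of a monomial ideal `J ⊆ S`, generated by the lifts of the
minimal monomial generators of `J`. -/
def liftIdeal (J : Ideal (SRing K k n)) : Ideal (MPRing K k n) :=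
  Ideal.span (liftMonomial K k n '' minGens K k n J)

/-- The projection `R → S ≅ R/(x_{1,0},…,x_{k,0})` sending `x_{i,0} ↦ 0` and
`x_{i,j} ↦ x_{i,j}` for `j ≥ 1`. -/
def projToS : MPRing K k n →ₐ[K] SRing K k n :=
  aeval (fun p : Sig k n =>
    if h : p.2 = 0 then 0 else MvPolynomial.X (⟨p.1, p.2.pred h⟩ : SigS k n))

/-- The point `[1:b_{i,1}:⋯:b_{i,n_i}] × ⋯` of multiprojective space associated to the
exponent vector `b` of a monomial of `S`. -/
def monToPoint (b : SigS k n →₀ ℕ) : MPPoint K k n := fun i =>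
  Projectivization.mk K
    (fun j : Fin (n i + 1) => if h : j = 0 then 1 else ((b ⟨i, j.pred h⟩ : ℕ) : K))
    (fun hc => by simpa using congrFun hc 0)

/-! ### Partitions -/

/-- `lam` is a partition: positive non-increasing entries. -/
def IsPartition {t : ℕ} (lam : Fin t → ℕ) : Prop :=
  (∀ j, 0 < lam j) ∧ Antitone lam

/-- `lam` is a partition of `s`. -/
def IsPartitionOf (s : ℕ) {t : ℕ} (lam : Fin t → ℕ) : Prop :=
  IsPartition lam ∧ ∑ j, lam j = s

/-- The `(i+1)`-st entry `λ*_{i+1} = #{j : λ_j ≥ i+1}` of the conjugate partition. -/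
def conjEntry {t : ℕ} (lam : Fin t → ℕ) (i : ℕ) : ℕ :=
  (Finset.univ.filter fun j : Fin t => i + 1 ≤ lam j).card

/-- `β` is the conjugate partition `α*` of `α`. -/
def IsConjugateOf {t m : ℕ} (α : Fin t → ℕ) (β : Fin m → ℕ) : Prop :=
  (∀ i : Fin m, β i = conjEntry α i) ∧ ∀ i : ℕ, m ≤ i → conjEntry α i = 0

/-! ### `ℙ^1 × ℙ^1` -/

/-- A point of `ℙ^1`. -/
abbrev Proj1 := Projectivization K (Fin 2 → K)

/-- A point of `ℙ^1 × ℙ^1`. -/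
abbrev Pt2 := MPPoint K 2 (fun _ => 1)

/-- The coordinate ring of `ℙ^1 × ℙ^1`. -/
abbrev R2 := MPRing K 2 (fun _ => 1)

/-- `P` enumerates the distinct first coordinates of `X` and `α` lists the sizes of the
corresponding fibers, in non-increasing order; so `α = α_X`. -/
def IsAlphaLabel (X : Set (Pt2 K)) {t : ℕ} (P : Fin t → Proj1 K) (α : Fin t → ℕ) : Prop :=
  Function.Injective P ∧ (Set.range P = (fun Z : Pt2 K => Z 0) '' X) ∧
  (∀ i, α i = Set.ncard {Z | Z ∈ X ∧ Z 0 = P i}) ∧ Antitone α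

/-- `Q` enumerates the distinct second coordinates of `X` and `β` lists the sizes of the
corresponding fibers, in non-increasing order; so `β = β_X`. -/
def IsBetaLabel (X : Set (Pt2 K)) {r : ℕ} (Q : Fin r → Proj1 K) (β : Fin r → ℕ) : Prop :=
  Function.Injective Q ∧ (Set.range Q = (fun Z : Pt2 K => Z 1) '' X) ∧
  (∀ i, β i = Set.ncard {Z | Z ∈ X ∧ Z 1 = Q i}) ∧ Antitone β

/-- `α = α_X`. -/
def IsAlphaPartition (X : Set (Pt2 K)) {t : ℕ} (α : Fin t → ℕ) : Prop :=
  ∃ P : Fin t → Proj1 K, IsAlphaLabel K X P α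

/-- `β = β_X`. -/
def IsBetaPartition (X : Set (Pt2 K)) {r : ℕ} (β : Fin r → ℕ) : Prop :=
  ∃ Q : Fin r → Proj1 K, IsBetaLabel K X Q β

/-- `F` is "the" form of degree `(1,0)` vanishing at all points of `ℙ^1 × ℙ^1` whose
first coordinate is `P`. -/
def IsForm1Of (P : Proj1 K) (F : R2 K) : Prop :=
  IsWeightedHomogeneous (wt 2 (fun _ => 1)) F (Pi.single 0 1) ∧ F ≠ 0 ∧
  ∀ x : Sig 2 (fun _ => 1) → K,
    (∃ c : K, (fun j : Fin 2 => x ⟨0, j⟩) = c • P.rep) → MvPolynomial.eval x F = 0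

/-- `F` is "the" form of degree `(0,1)` vanishing at all points of `ℙ^1 × ℙ^1` whose
second coordinate is `P`. -/
def IsForm2Of (P : Proj1 K) (F : R2 K) : Prop :=
  IsWeightedHomogeneous (wt 2 (fun _ => 1)) F (Pi.single 1 1) ∧ F ≠ 0 ∧
  ∀ x : Sig 2 (fun _ => 1) → K,
    (∃ c : K, (fun j : Fin 2 => x ⟨1, j⟩) = c • P.rep) → MvPolynomial.eval x F = 0

end PaperMP

namespace PaperMP

section Lifting

variable {K : Type} [Field K] {k : ℕ} {n : Fin k → ℕ}

/-- The lifted power `∏_{l < a} (x_{i,j} - l x_{i,0})` of a single variable. -/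
def liftPower (p : SigS k n) (a : ℕ) : MPRing K k n :=
  ∏ l ∈ Finset.range a,
    (X (⟨p.1, p.2.succ⟩ : Sig k n) - (l : MPRing K k n) * X ⟨p.1, 0⟩)

lemma liftMonomial_eq_prod (b : SigS k n →₀ ℕ) :
    liftMonomial K k n b = ∏ p, liftPower p (b p) := by
  refine Finset.prod_subset (Finset.subset_univ _) fun p _ hp => ?_
  simp [Finsupp.notMem_support_iff.mp hp]

lemma liftMonomial_zero : liftMonomial K k n 0 = 1 := by
  simp [liftMonomial]

lemma liftMonomial_dvd {a b : SigS k n →₀ ℕ} (h : a ≤ b) :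
    liftMonomial K k n a ∣ liftMonomial K k n b := by
  rw [liftMonomial_eq_prod, liftMonomial_eq_prod]
  exact Finset.prod_dvd_prod_of_dvd _ _ fun p _ =>
    Finset.prod_dvd_prod_of_subset _ _ _ (Finset.range_subset_range.mpr (h p))

lemma liftMonomial_add_single (b : SigS k n →₀ ℕ) (p : SigS k n) :
    liftMonomial K k n (b + Finsupp.single p 1) =
      (X ⟨p.1, p.2.succ⟩ - (b p : MPRing K k n) * X ⟨p.1, 0⟩) * liftMonomial K k n b := by
  classical
  rw [liftMonomial_eq_prod, liftMonomial_eq_prod,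
    ← Finset.mul_prod_erase (h := Finset.mem_univ p),
    ← Finset.mul_prod_erase (f := fun q => liftPower q (b q)) (h := Finset.mem_univ p),
    ← mul_assoc]
  congr 1
  · simp [liftPower, Finset.prod_range_succ, mul_comm]
  · refine Finset.prod_congr rfl fun q hq => ?_
    simp [Finsupp.single_eq_of_ne (Finset.ne_of_mem_erase hq)]

/-- The inclusion of `K[x_{1,0},…,x_{k,0}]` in `R`. -/
def baseIncl : MvPolynomial (Fin k) K →ₐ[K] MPRing K k n :=
  rename fun i => ⟨i, 0⟩

/-- The combination of lifted monomials with coefficients in `K[x_{1,0},…,x_{k,0}]`. -/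
def liftComb : ((SigS k n →₀ ℕ) →₀ MvPolynomial (Fin k) K) →+ MPRing K k n :=
  Finsupp.liftAddHom fun b =>
    (AddMonoidHom.mulRight (liftMonomial K k n b)).comp
      ((baseIncl (K := K) (n := n)).toRingHom : _ →+* _).toAddMonoidHom

lemma liftComb_apply (g : (SigS k n →₀ ℕ) →₀ MvPolynomial (Fin k) K) :
    liftComb g = ∑ b ∈ g.support, baseIncl (g b) * liftMonomial K k n b := rfl

lemma liftComb_single (b : SigS k n →₀ ℕ) (q : MvPolynomial (Fin k) K) :
    liftComb (Finsupp.single b q) = baseIncl q * liftMonomial K k n b := by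
  simp [liftComb]

lemma liftComb_mul_X_mem_range (g : (SigS k n →₀ ℕ) →₀ MvPolynomial (Fin k) K) (p : Sig k n) :
    liftComb g * X p ∈ (liftComb (K := K) (n := n)).range := by
  induction g using Finsupp.induction_linear with
  | zero => simp
  | add f g hf hg =>
    rw [map_add, add_mul]
    exact add_mem hf hg
  | single b q =>
    rw [liftComb_single]
    obtain ⟨i, j⟩ := p
    have hX : baseIncl (n := n) (X i : MvPolynomial (Fin k) K) = X ⟨i, 0⟩ := by simp [baseIncl]
    cases j using Fin.cases with
    | zero =>
      refine ⟨Finsupp.single b (q * X i), ?_⟩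
      rw [liftComb_single, map_mul, hX]
      ring
    | succ j =>
      refine ⟨Finsupp.single (b + Finsupp.single ⟨i, j⟩ 1) q +
        Finsupp.single b (q * ((b ⟨i, j⟩ : MvPolynomial (Fin k) K) * X i)), ?_⟩
      rw [map_add, liftComb_single, liftComb_single, liftMonomial_add_single, map_mul, map_mul,
        hX, map_natCast]
      ring

/-- The lifted monomials span `R` over `K[x_{1,0},…,x_{k,0}]`. -/
lemma liftComb_surjective : Function.Surjective (liftComb (K := K) (n := n)) := by
  intro f
  induction f using MvPolynomial.induction_on with
  | C a => exact ⟨Finsupp.single 0 (C a), by simp [liftComb_single, liftMonomial_zero, baseIncl]⟩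
  | add f g hf hg =>
    obtain ⟨a, rfl⟩ := hf
    obtain ⟨b, rfl⟩ := hg
    exact ⟨a + b, map_add _ _ _⟩
  | mul_X f p hf =>
    obtain ⟨a, rfl⟩ := hf
    exact liftComb_mul_X_mem_range a p

/-- The representative of the point attached to `b` with scaling factors `c`. -/
def scaledPoint (b : SigS k n →₀ ℕ) (c : Fin k → K) : Sig k n → K := fun p =>
  c p.1 * (if h : p.2 = 0 then 1 else ((b ⟨p.1, p.2.pred h⟩ : ℕ) : K))

lemma scaledPoint_zero (b : SigS k n →₀ ℕ) (c : Fin k → K) (i : Fin k) :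
    scaledPoint b c ⟨i, 0⟩ = c i := by
  simp [scaledPoint]

lemma scaledPoint_succ (b : SigS k n →₀ ℕ) (c : Fin k → K) (p : SigS k n) :
    scaledPoint b c ⟨p.1, p.2.succ⟩ = c p.1 * b p := by
  simp [scaledPoint]

lemma eval_scaledPoint_baseIncl (b : SigS k n →₀ ℕ) (c : Fin k → K)
    (q : MvPolynomial (Fin k) K) : eval (scaledPoint b c) (baseIncl q) = eval c q := by
  rw [baseIncl, eval_rename]
  congr 2
  funext i
  exact scaledPoint_zero b c i

lemma eval_scaledPoint_liftPower (b : SigS k n →₀ ℕ) (c : Fin k → K) (p : SigS k n) (a : ℕ) :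
    eval (scaledPoint b c) (liftPower p a) =
      ∏ l ∈ Finset.range a, (((b p : K) - l) * c p.1) := by
  rw [liftPower, map_prod]
  refine Finset.prod_congr rfl fun l _ => ?_
  rw [map_sub, map_mul, eval_X, eval_X, map_natCast, scaledPoint_succ, scaledPoint_zero]
  ring

lemma eval_scaledPoint_liftMonomial_eq_zero {a b : SigS k n →₀ ℕ} (h : ¬ a ≤ b)
    (c : Fin k → K) : eval (scaledPoint b c) (liftMonomial K k n a) = 0 := by
  obtain ⟨p, hp⟩ : ∃ p, b p < a p := by
    by_contra! hab
    exact h hab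
  rw [liftMonomial_eq_prod, map_prod]
  refine Finset.prod_eq_zero (Finset.mem_univ p) ?_
  rw [eval_scaledPoint_liftPower]
  exact Finset.prod_eq_zero (Finset.mem_range.mpr hp) (by simp)

lemma eval_scaledPoint_liftMonomial_self_ne_zero [CharZero K] (b : SigS k n →₀ ℕ)
    {c : Fin k → K} (hc : ∀ i, c i ≠ 0) :
    eval (scaledPoint b c) (liftMonomial K k n b) ≠ 0 := by
  rw [liftMonomial_eq_prod, map_prod]
  refine Finset.prod_ne_zero_iff.mpr fun p _ => ?_
  rw [eval_scaledPoint_liftPower]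
  refine Finset.prod_ne_zero_iff.mpr fun l hl => mul_ne_zero ?_ (hc _)
  rw [sub_ne_zero, Ne, Nat.cast_inj]
  exact (Finset.mem_range.mp hl).ne'

lemma eq_zero_of_eval_eq_zero_of_ne_zero [Infinite K] (q : MvPolynomial (Fin k) K)
    (h : ∀ c : Fin k → K, (∀ i, c i ≠ 0) → eval c q = 0) : q = 0 := by
  have hprod : q * ∏ i, X i = 0 := by
    refine MvPolynomial.funext fun c => ?_
    rw [map_mul, map_zero, map_prod]
    by_cases hc : ∀ i, c i ≠ 0
    · rw [h c hc, zero_mul]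
    · push Not at hc
      obtain ⟨i, hi⟩ := hc
      rw [Finset.prod_eq_zero (Finset.mem_univ i) (by simpa using hi), mul_zero]
  exact (mul_eq_zero.mp hprod).resolve_right
    (Finset.prod_ne_zero_iff.mpr fun i _ => X_ne_zero i)

/-- A combination of lifted monomials vanishing at the points attached to its support is zero. -/
lemma eq_zero_of_eval_liftComb_eq_zero [CharZero K]
    (g : (SigS k n →₀ ℕ) →₀ MvPolynomial (Fin k) K)
    (h : ∀ b ∈ g.support, ∀ c : Fin k → K, eval (scaledPoint b c) (liftComb g) = 0) : g = 0 := by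
  have : Infinite K := Infinite.of_injective _ (Nat.cast_injective (R := K))
  by_contra hg
  obtain ⟨b, hb⟩ := g.support.exists_minimal (Finsupp.support_nonempty_iff.mpr hg)
  refine Finsupp.mem_support_iff.mp hb.prop (eq_zero_of_eval_eq_zero_of_ne_zero _ fun c hc => ?_)
  have hz := h b hb.prop c
  rw [liftComb_apply, map_sum, Finset.sum_eq_single_of_mem b hb.prop, map_mul,
    eval_scaledPoint_baseIncl] at hz
  · exact (mul_eq_zero.mp hz).resolve_right (eval_scaledPoint_liftMonomial_self_ne_zero b hc)
  · intro a ha hab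
    rw [map_mul, eval_scaledPoint_liftMonomial_eq_zero
      (fun hle => hab (hle.antisymm (hb.le_of_le ha hle))), mul_zero]

lemma mem_idealOfPoint_monToPoint_iff [IsAlgClosed K] [CharZero K] (b : SigS k n →₀ ℕ)
    (f : MPRing K k n) :
    f ∈ idealOfPoint K k n (monToPoint K k n b) ↔
      ∀ c : Fin k → K, eval (scaledPoint b c) f = 0 := by
  have hrep : ∀ i, ∃ a : Kˣ, ∀ j : Fin (n i + 1), a * (monToPoint K k n b i).rep j =
      if h : j = 0 then 1 else ((b ⟨i, j.pred h⟩ : ℕ) : K) := by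
    intro i
    obtain ⟨a, ha⟩ := (Projectivization.mk_eq_mk_iff K _ _
      (fun hc => by simpa using congrFun hc 0) (Projectivization.rep_nonzero _)).mp
      (Projectivization.mk_rep (monToPoint K k n b i)).symm
    exact ⟨a, fun j => congrFun ha j⟩
  choose a ha using hrep
  simp only [idealOfPoint, vanishingIdeal, Submodule.mem_iInf, RingHom.mem_ker]
  constructor
  · intro h c
    refine h _ fun i => ⟨c i * a i, ?_⟩
    funext j
    simp [scaledPoint, ← ha, mul_assoc]
  · intro h x hx
    choose c hc using hx
    convert h fun i => c i * (a i : K)⁻¹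
    funext ⟨i, j⟩
    rw [scaledPoint, ← ha]
    simpa [mul_assoc] using congrFun (hc i) j

lemma monomial_mem_of_le {J : Ideal (SRing K k n)} {a b : SigS k n →₀ ℕ} (h : a ≤ b)
    (ha : (monomial a (1 : K) : SRing K k n) ∈ J) :
    (monomial b (1 : K) : SRing K k n) ∈ J := by
  have hmul : (monomial b (1 : K) : SRing K k n) = monomial (b - a) 1 * monomial a 1 := by
    rw [monomial_mul, one_mul, tsub_add_cancel_of_le h]
  rw [hmul]
  exact J.mul_mem_left _ ha

lemma exists_mem_minGens_le [IsAlgClosed K] [CharZero K] {J : Ideal (SRing K k n)}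
    {b : SigS k n →₀ ℕ}
    (hb : (monomial b (1 : K) : SRing K k n) ∈ J) : ∃ a ∈ minGens K k n J, a ≤ b := by
  obtain ⟨a, hab, ha⟩ := exists_minimal_le_of_wellFoundedLT
    (fun a : SigS k n →₀ ℕ => (monomial a (1 : K) : SRing K k n) ∈ J) b hb
  exact ⟨a, ⟨ha.prop, fun b' hle hne hmem => hne (hle.antisymm (ha.le_of_le hmem hle))⟩, hab⟩

lemma liftMonomial_mem_liftIdeal [IsAlgClosed K] [CharZero K] {J : Ideal (SRing K k n)}
    {b : SigS k n →₀ ℕ}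
    (hb : (monomial b (1 : K) : SRing K k n) ∈ J) :
    liftMonomial K k n b ∈ liftIdeal K k n J := by
  obtain ⟨a, ha, hab⟩ := exists_mem_minGens_le hb
  exact Ideal.mem_of_dvd _ (liftMonomial_dvd hab) (Ideal.subset_span ⟨a, ha, rfl⟩)

end Lifting

/-- the lift of a monomial ideal `J ⊆ S` is the vanishing ideal of the
set of points `M̄` of multiprojective space coming from the monomials not in `J`. -/
theorem statement_6 (K : Type) [Field K] [IsAlgClosed K] [CharZero K]
    (k : ℕ) (n : Fin k → ℕ)
    (J : Ideal (SRing K k n)) (hJmon : IsMonomialIdeal K k n J)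
    (I : Ideal (MPRing K k n)) (hI : I = liftIdeal K k n J) :
    I = idealOfSet K k n
      {P | ∃ b : SigS k n →₀ ℕ,
        (MvPolynomial.monomial b (1 : K) : SRing K k n) ∉ J ∧ P = monToPoint K k n b} := by
  classical
  subst hI
  have hmem : ∀ f : MPRing K k n, f ∈ idealOfSet K k n
      {P | ∃ b : SigS k n →₀ ℕ,
        (MvPolynomial.monomial b (1 : K) : SRing K k n) ∉ J ∧ P = monToPoint K k n b} ↔
      ∀ b : SigS k n →₀ ℕ, (MvPolynomial.monomial b (1 : K) : SRing K k n) ∉ J →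
        ∀ c : Fin k → K, eval (scaledPoint b c) f = 0 := by
    intro f
    simp only [idealOfSet, Submodule.mem_iInf, Set.mem_ofPred_eq]
    constructor
    · exact fun h b hb => (mem_idealOfPoint_monToPoint_iff b f).mp (h _ ⟨b, hb, rfl⟩)
    · rintro h _ ⟨b, hb, rfl⟩
      exact (mem_idealOfPoint_monToPoint_iff b f).mpr (h b hb)
  have hle : liftIdeal K k n J ≤ idealOfSet K k n
      {P | ∃ b : SigS k n →₀ ℕ,
        (MvPolynomial.monomial b (1 : K) : SRing K k n) ∉ J ∧ P = monToPoint K k n b} := by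
    refine Ideal.span_le.mpr ?_
    rintro _ ⟨a, ha, rfl⟩
    exact (hmem _).mpr fun b hb c => eval_scaledPoint_liftMonomial_eq_zero
      (fun hab => hb (monomial_mem_of_le hab ha.1)) c
  refine le_antisymm hle fun f hf => ?_
  obtain ⟨g, rfl⟩ := liftComb_surjective f
  let inJ : (SigS k n →₀ ℕ) → Prop := fun b => (monomial b (1 : K) : SRing K k n) ∈ J
  have hin : liftComb (g.filter inJ) ∈ liftIdeal K k n J := by
    rw [liftComb_apply]
    refine Ideal.sum_mem _ fun b hb => Ideal.mul_mem_left _ _ (liftMonomial_mem_liftIdeal ?_)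
    rw [Finsupp.support_filter, Finset.mem_filter] at hb
    exact hb.2
  have hsplit : liftComb g = liftComb (g.filter inJ) + liftComb (g.filter fun b => ¬ inJ b) := by
    rw [← map_add, Finsupp.filter_add_filter_not]
  rw [hsplit] at hf ⊢
  have hout := (hmem _).mp ((Ideal.add_mem_iff_right _ (hle hin)).mp hf)
  rw [eq_zero_of_eval_liftComb_eq_zero (g.filter fun b => ¬ inJ b), map_zero, add_zero]
  · exact hin
  · intro b hb
    rw [Finsupp.support_filter, Finset.mem_filter] at hb
    exact hout b hb.2

end PaperMP
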